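/- (Uniqueness of the DPPI strategy) Let S, B, r, m, α, V_0 be as in the DPPI setting, and let (ξ, η) be the DPPI strategy with value V and cushion C = V − αV_0 B constructed via the explicit exponential formula. Suppose (ξ', η') is any self-financing strategy with value V' = ξ'S + η'B and cushion C' = V' − αV_0B satisfying V'_0 = V_0 and ξ'_t = m_t C'_t / S_t for all t. Then C'_t = C_t, ξ'_t = ξ_t, and η'_t = η_t for all t ≥ 0. -/

import Mathlib

open Filter Topology Set MeasureTheory

/-- A refining sequence of time grids: each grid is a strictly increasing
sequence starting at 0 and tending to infinity; grids are nested and the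
mesh tends to zero. -/
structure GridSeq where
  T : ℕ → ℕ → ℝ
  zero : ∀ N, T N 0 = 0
  mono : ∀ N, StrictMono (T N)
  unbounded : ∀ N, Filter.Tendsto (T N) Filter.atTop Filter.atTop
  nested : ∀ N, Set.range (T N) ⊆ Set.range (T (N + 1))
  mesh : ∀ ε > 0, ∃ N₀, ∀ N ≥ N₀, ∀ i, T N (i + 1) - T N i ≤ ε

/-- The grid sum `∑_{t_i, t_{i+1} ∈ τ, t_{i+1} ≤ t} f(t_i, t_{i+1})`. -/
noncomputable def gridSum (τ : ℕ → ℝ) (f : ℝ → ℝ → ℝ) (t : ℝ) : ℝ :=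
  ∑' i : ℕ, if τ (i + 1) ≤ t then f (τ i) (τ (i + 1)) else 0

/-- The grid sums of `f` along the grid sequence `G` converge to `L` at time `t`. -/
def ConvTo (G : GridSeq) (f : ℝ → ℝ → ℝ) (t L : ℝ) : Prop :=
  Filter.Tendsto (fun N => gridSum (G.T N) f t) Filter.atTop (nhds L)

/-- `X` has continuous quadratic variation `Q` along the grid sequence `G`. -/
def HasQV (G : GridSeq) (X Q : ℝ → ℝ) : Prop :=
  ContinuousOn Q (Set.Ici 0) ∧ Q 0 = 0 ∧
    ∀ t, ConvTo G (fun u v => (X v - X u) ^ 2) t (Q t)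

/-- `A` is locally of finite variation on `[0,∞)`. -/
def LocBV (A : ℝ → ℝ) : Prop := ∀ T > 0, BoundedVariationOn A (Set.Icc 0 T)

/-- `ξ` is an admissible integrand for `X`: locally `ξ_t = g(A_t, X_t)` with
`g ∈ C¹` and `A` continuous of finite variation. -/
def Admissible (X ξ : ℝ → ℝ) : Prop :=
  ∀ T > 0, ∃ (n : ℕ) (g : (Fin n → ℝ) → ℝ → ℝ) (A : ℝ → Fin n → ℝ),
    ContDiff ℝ 1 (Function.uncurry g) ∧
    (∀ k, ContinuousOn (fun t => A t k) (Set.Icc 0 T) ∧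
      BoundedVariationOn (fun t => A t k) (Set.Icc 0 T)) ∧
    ∀ t ∈ Set.Icc (0 : ℝ) T, ξ t = g (A t) (X t)

/-- A self-financing strategy `(ξ, η)` with value `V` in the pathwise setting:
`ξ` is admissible for `S`, `η r` is locally integrable, `V = ξ S + η B`, and
`V_t = V_0 + ∫_0^t ξ dS + ∫_0^t η dB`, where `∫ ξ dS` is a pathwise Itô
integral and `∫ η dB = ∫ η r B ds`. -/
def SelfFinancing (G : GridSeq) (S B r ξ η V : ℝ → ℝ) : Prop :=
  Admissible S ξ ∧
  (∀ t > 0, IntervalIntegrable (fun s => |η s * r s|) MeasureTheory.volume 0 t) ∧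
  (∀ t, V t = ξ t * S t + η t * B t) ∧
  ∀ t ≥ 0, ∃ I, ConvTo G (fun u v => ξ u * (S v - S u)) t I ∧
    V t = V 0 + I + ∫ s in (0 : ℝ)..t, η s * r s * B s

/-- The set of all grid points of a grid sequence. -/
def GridSeq.points (G : GridSeq) : Set ℝ := ⋃ N, Set.range (G.T N)

theorem GridSeq.mem_points (G : GridSeq) (N i : ℕ) : G.T N i ∈ G.points :=
  Set.mem_iUnion.2 ⟨N, i, rfl⟩

theorem GridSeq.nonneg (G : GridSeq) (N i : ℕ) : 0 ≤ G.T N i := by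
  rw [← G.zero N]; exact (G.mono N).monotone (Nat.zero_le i)

theorem GridSeq.points_nonneg (G : GridSeq) {u : ℝ} (hu : u ∈ G.points) : 0 ≤ u := by
  obtain ⟨N, i, rfl⟩ := Set.mem_iUnion.1 hu
  exact G.nonneg N i

theorem GridSeq.range_mono (G : GridSeq) {M N : ℕ} (h : M ≤ N) :
    Set.range (G.T M) ⊆ Set.range (G.T N) :=
  monotone_nat_of_le_succ (f := fun N => Set.range (G.T N)) G.nested h

/-- Every time lies in a unique cell of the grid of level `N`, and the grid sums up to that time
run over the earlier cells. -/
theorem GridSeq.exists_cell (G : GridSeq) (N : ℕ) {v : ℝ} (hv : 0 ≤ v) :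
    ∃ k, G.T N k ≤ v ∧ v < G.T N (k + 1) ∧
      ∀ f : ℝ → ℝ → ℝ, gridSum (G.T N) f v =
        ∑ i ∈ Finset.range k, f (G.T N i) (G.T N (i + 1)) := by
  classical
  have hex : ∃ k, v < G.T N k := ((G.unbounded N).eventually_gt_atTop v).exists
  have hpos : Nat.find hex ≠ 0 := by
    intro h
    have := Nat.find_spec hex
    rw [h, G.zero] at this
    exact absurd hv (not_le.2 this)
  obtain ⟨k, hk⟩ := Nat.exists_eq_succ_of_ne_zero hpos
  have h2 : v < G.T N (k + 1) := by
    have := Nat.find_spec hex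
    rwa [hk] at this
  have h1 : G.T N k ≤ v := not_lt.1 (Nat.find_min hex (by omega))
  refine ⟨k, h1, h2, fun f => ?_⟩
  unfold gridSum
  rw [tsum_eq_sum (s := Finset.range k)]
  · refine Finset.sum_congr rfl fun i hi => if_pos ?_
    exact ((G.mono N).monotone (by have := Finset.mem_range.1 hi; omega)).trans h1
  · intro i hi
    refine if_neg (not_le.2 (h2.trans_le ((G.mono N).monotone ?_)))
    have := mt Finset.mem_range.2 hi
    omega

/-- The level `N` grid cells between a grid point `u` and a later time `v`. -/
theorem GridSeq.exists_cells (G : GridSeq) (N : ℕ) {u v : ℝ} (hu : u ∈ Set.range (G.T N))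
    (huv : u ≤ v) :
    ∃ (n : ℕ) (s : ℕ → ℝ), s 0 = u ∧ StrictMono s ∧ s n ≤ v ∧ v < s (n + 1) ∧
      (∀ i, ∃ j, s i = G.T N j ∧ s (i + 1) = G.T N (j + 1)) ∧
      ∀ f : ℝ → ℝ → ℝ, gridSum (G.T N) f v - gridSum (G.T N) f u =
        ∑ i ∈ Finset.range n, f (s i) (s (i + 1)) := by
  obtain ⟨j, rfl⟩ := hu
  obtain ⟨k, hk1, hk2, hk⟩ := G.exists_cell N ((G.nonneg N j).trans huv)
  obtain ⟨l, hl1, hl2, hl⟩ := G.exists_cell N (G.nonneg N j)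
  have hlj : l = j := by
    have h1 := (G.mono N).le_iff_le.1 hl1
    have h2 := (G.mono N).lt_iff_lt.1 hl2
    omega
  subst hlj
  have hlk : l ≤ k := by
    have := (G.mono N).lt_iff_lt.1 (huv.trans_lt hk2)
    omega
  refine ⟨k - l, fun i => G.T N (l + i), rfl, fun a b hab => G.mono N (by omega), ?_, ?_,
    fun i => ⟨l + i, rfl, rfl⟩, fun f => ?_⟩
  · simpa [Nat.add_sub_cancel' hlk] using hk1
  · have : l + (k - l + 1) = k + 1 := by omega
    simpa only [this] using hk2
  · rw [hk, hl, ← Finset.sum_Ico_eq_sub _ hlk, Finset.sum_Ico_eq_sum_range]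
    rfl

theorem GridSeq.exists_refinement (G : GridSeq) {u v : ℝ} (hu : u ∈ G.points) (huv : u ≤ v) :
    ∃ (n : ℕ → ℕ) (s : ℕ → ℕ → ℝ), (∀ N, s N 0 = u) ∧ (∀ N, StrictMono (s N)) ∧
      (∀ N, s N (n N) ≤ v) ∧ (∀ N i, s N i ∈ G.points) ∧
      Tendsto (fun N => s N (n N)) atTop (𝓝 v) ∧
      ∀ f a b, ConvTo G f u a → ConvTo G f v b →
        Tendsto (fun N => ∑ i ∈ Finset.range (n N), f (s N i) (s N (i + 1))) atTop
          (𝓝 (b - a)) := by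
  obtain ⟨N₀, hN₀⟩ := Set.mem_iUnion.1 hu
  have h := fun N => G.exists_cells (N + N₀) (G.range_mono (Nat.le_add_left N₀ N) hN₀) huv
  choose n s h0 hmono hle hlt hcell hsum using h
  refine ⟨n, s, h0, hmono, hle, fun N i => ?_, ?_, fun f a b ha hb => ?_⟩
  · obtain ⟨j, hj, -⟩ := hcell N i
    exact hj ▸ G.mem_points _ _
  · rw [Metric.tendsto_atTop]
    intro ε hε
    obtain ⟨N₁, hN₁⟩ := G.mesh (ε / 2) (by positivity)
    refine ⟨N₁, fun N hN => ?_⟩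
    obtain ⟨j, hj, hj'⟩ := hcell N (n N)
    have h1 := hN₁ (N + N₀) (by omega) j
    have h2 := hlt N
    rw [Real.dist_eq, abs_sub_comm, abs_of_nonneg (sub_nonneg.2 (hle N))]
    linarith
  · have h1 := ((hb.sub ha).comp (tendsto_add_atTop_nat N₀))
    refine h1.congr fun N => ?_
    exact hsum N f

/-- Partitions of `[0, t]` by grid points, up to a last incomplete cell, with small mesh. -/
theorem GridSeq.exists_partition (G : GridSeq) {δ t : ℝ} (hδ : 0 < δ) (ht : 0 ≤ t) :
    ∃ (n : ℕ) (s : ℕ → ℝ), s 0 = 0 ∧ StrictMono s ∧ s n ≤ t ∧ t ≤ s n + δ ∧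
      (∀ i, s i ∈ G.points) ∧ ∀ i, s (i + 1) ≤ s i + δ := by
  obtain ⟨N, hN⟩ := G.mesh δ hδ
  obtain ⟨n, h1, h2, -⟩ := G.exists_cell N ht
  have hm := fun i => hN N le_rfl i
  exact ⟨n, G.T N, G.zero N, G.mono N, h1, by linarith [hm n], G.mem_points N,
    fun i => by linarith [hm i]⟩

theorem HasQV.mono {G : GridSeq} {X Q : ℝ → ℝ} (h : HasQV G X Q) {u v : ℝ} (hu : 0 ≤ u)
    (huv : u ≤ v) : Q u ≤ Q v := by
  refine le_of_tendsto_of_tendsto' (h.2.2 u) (h.2.2 v) fun N => ?_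
  obtain ⟨k, hk1, hk2, hk⟩ := G.exists_cell N hu
  obtain ⟨l, hl1, hl2, hl⟩ := G.exists_cell N (hu.trans huv)
  rw [hk, hl]
  have hkl : k ≤ l := by
    have := (G.mono N).lt_iff_lt.1 ((hk1.trans huv).trans_lt hl2)
    omega
  exact Finset.sum_le_sum_of_subset_of_nonneg (Finset.range_subset_range.2 hkl)
    fun i _ _ => sq_nonneg _

theorem exists_modulus {E : Type*} [PseudoMetricSpace E] {f : ℝ → E} {T : ℝ}
    (hf : ContinuousOn f (Set.Icc 0 T)) {ε : ℝ} (hε : 0 < ε) :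
    ∃ δ > 0, ∀ u v, 0 ≤ u → u ≤ v → v ≤ T → v ≤ u + δ → dist (f v) (f u) ≤ ε := by
  obtain ⟨δ, hδ, h⟩ := Metric.uniformContinuousOn_iff.1
    (isCompact_Icc.uniformContinuousOn_of_continuous hf) ε hε
  refine ⟨δ / 2, by positivity, fun u v hu huv hv hvd => ?_⟩
  refine (h v ⟨hu.trans huv, hv⟩ u ⟨hu, huv.trans hv⟩ ?_).le
  rw [Real.dist_eq, abs_of_nonneg (sub_nonneg.2 huv)]
  linarith

theorem exists_abs_le {f : ℝ → ℝ} {T : ℝ} (hf : ContinuousOn f (Set.Icc 0 T)) :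
    ∃ M > 0, ∀ u, 0 ≤ u → u ≤ T → |f u| ≤ M := by
  obtain ⟨M, hM⟩ := isCompact_Icc.exists_bound_of_continuousOn hf
  exact ⟨max M 1, by positivity, fun u h0 hT => (hM u ⟨h0, hT⟩).trans (le_max_left _ _)⟩

/-- Taylor estimate for a Riemann sum `∑ g(aᵢ, xᵢ) (xᵢ₊₁ - xᵢ)` around its starting point. -/
theorem abs_riemannSum_sub_le {E : Type*} [NormedAddCommGroup E] {g g' : E → ℝ → ℝ}
    (hg : ∀ a y, HasDerivAt (g a) (g' a y) y) {D : Set E} {J : Set ℝ} (hJ : J.OrdConnected)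
    {q L ε : ℝ} {x : ℕ → ℝ} {a : ℕ → E} {n : ℕ}
    (hx : ∀ i ≤ n, x i ∈ J) (ha : ∀ i ≤ n, a i ∈ D)
    (hg' : ∀ b ∈ D, ∀ y ∈ J, |g' b y - q| ≤ ε)
    (hL : ∀ b ∈ D, ∀ c ∈ D, ∀ y ∈ J, |g b y - g c y| ≤ L * ‖b - c‖)
    (hLε : ∀ y ∈ J, L * |y - x 0| ≤ ε) :
    |∑ i ∈ Finset.range n, g (a i) (x i) * (x (i + 1) - x i) - g (a 0) (x 0) * (x n - x 0)
        - q / 2 * ((x n - x 0) ^ 2 - ∑ i ∈ Finset.range n, (x (i + 1) - x i) ^ 2)| ≤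
      ε * ((x n - x 0) ^ 2 + ∑ i ∈ Finset.range n, (x (i + 1) - x i) ^ 2 +
        2 * ∑ i ∈ Finset.range n, ‖a (i + 1) - a i‖) := by
  have hcont : ∀ b, Continuous (g b) := fun b =>
    continuous_iff_continuousAt.2 fun y => (hg b y).continuousAt
  have hint : ∀ b y z, IntervalIntegrable (g b) volume y z := fun b y z =>
    (hcont b).intervalIntegrable _ _
  have hsec : ∀ b ∈ D, ∀ y ∈ J, ∀ z ∈ J,
      |(∫ w in y..z, g b w) - g b y * (z - y) - q / 2 * (z - y) ^ 2| ≤ ε * (z - y) ^ 2 := by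
    intro b hb y hy z hz
    have hsub : Set.uIcc y z ⊆ J := hJ.uIcc_subset hy hz
    have key : (∫ w in y..z, g b w) - g b y * (z - y) - q / 2 * (z - y) ^ 2 =
        ∫ w in y..z, (g b w - g b y - q * (w - y)) := by
      rw [intervalIntegral.integral_sub (by
          exact ((hcont b).sub continuous_const).intervalIntegrable _ _)
          (by exact Continuous.intervalIntegrable (by fun_prop) _ _),
        intervalIntegral.integral_sub (hint _ _ _) (by simp),
        intervalIntegral.integral_const, intervalIntegral.integral_const_mul,
        intervalIntegral.integral_sub (by simp) (by simp), integral_id,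
        intervalIntegral.integral_const]
      simp only [smul_eq_mul]
      ring
    rw [key]
    have hb1 : ∀ w ∈ Set.uIoc y z, ‖g b w - g b y - q * (w - y)‖ ≤ ε * |z - y| := by
      intro w hw
      have hw' : w ∈ Set.uIcc y z := Set.uIoc_subset_uIcc hw
      have hmv := Convex.norm_image_sub_le_of_norm_hasDerivWithin_le
        (f := fun w => g b w - q * w) (f' := fun w => g' b w - q) (s := Set.uIcc y z) (C := ε)
        (fun w _ => by
          simpa [Pi.sub_def] using
            ((hg b w).sub ((hasDerivAt_id w).const_mul q)).hasDerivWithinAt)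
        (fun w hw => hg' b hb w (hsub hw)) (convex_uIcc y z) Set.left_mem_uIcc hw'
      have hε : 0 ≤ ε := (abs_nonneg _).trans (hg' b hb y hy)
      have h1 : |w - y| ≤ |z - y| := Set.abs_sub_left_of_mem_uIcc hw'
      calc ‖g b w - g b y - q * (w - y)‖ = ‖g b w - q * w - (g b y - q * y)‖ := by
            congr 1; ring
        _ ≤ ε * ‖w - y‖ := hmv
        _ ≤ ε * |z - y| := by rw [Real.norm_eq_abs]; gcongr
    calc _ = ‖∫ w in y..z, (g b w - g b y - q * (w - y))‖ := rfl
      _ ≤ ε * |z - y| * |z - y| := intervalIntegral.norm_integral_le_of_norm_le_const hb1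
      _ = ε * (z - y) ^ 2 := by rw [mul_assoc, abs_mul_abs_self]; ring
  have hchange : ∀ b ∈ D, ∀ c ∈ D, ∀ z ∈ J,
      |(∫ w in x 0..z, g b w) - ∫ w in x 0..z, g c w| ≤ ε * ‖b - c‖ := by
    intro b hb c hc z hz
    have hsub : Set.uIcc (x 0) z ⊆ J := hJ.uIcc_subset (hx 0 (Nat.zero_le n)) hz
    rw [← intervalIntegral.integral_sub (hint _ _ _) (hint _ _ _)]
    calc _ = ‖∫ w in x 0..z, (g b w - g c w)‖ := rfl
      _ ≤ L * ‖b - c‖ * |z - x 0| := intervalIntegral.norm_integral_le_of_norm_le_const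
          fun w hw => hL b hb c hc w (hsub (Set.uIoc_subset_uIcc hw))
      _ = L * |z - x 0| * ‖b - c‖ := by ring
      _ ≤ ε * ‖b - c‖ := by gcongr; exact hLε z hz
  have hstep : ∀ k ≤ n, |(∫ w in x 0..x k, g (a k) w)
      - ∑ i ∈ Finset.range k, g (a i) (x i) * (x (i + 1) - x i)
      - q / 2 * ∑ i ∈ Finset.range k, (x (i + 1) - x i) ^ 2| ≤
      ε * (∑ i ∈ Finset.range k, (x (i + 1) - x i) ^ 2 +
        ∑ i ∈ Finset.range k, ‖a (i + 1) - a i‖) := by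
    intro k
    induction k with
    | zero => intro _; simp
    | succ k ih =>
      intro hk
      have h0 := ih (by omega)
      have h1 := hchange _ (ha (k + 1) hk) _ (ha k (by omega)) _ (hx (k + 1) hk)
      have h2 := hsec _ (ha k (by omega)) _ (hx k (by omega)) _ (hx (k + 1) hk)
      have h3 : (∫ w in x 0..x (k + 1), g (a k) w) =
          (∫ w in x 0..x k, g (a k) w) + ∫ w in x k..x (k + 1), g (a k) w :=
        (intervalIntegral.integral_add_adjacent_intervals (hint _ _ _) (hint _ _ _)).symm
      simp only [Finset.sum_range_succ]
      rw [abs_le] at h0 h1 h2 ⊢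
      constructor <;> linarith [h0.1, h0.2, h1.1, h1.2, h2.1, h2.2]
  have h0 := hstep n le_rfl
  have h0n : 0 ≤ n := Nat.zero_le n
  have h2 := hsec _ (ha 0 h0n) _ (hx 0 h0n) _ (hx n le_rfl)
  have h1 : |(∫ w in x 0..x n, g (a n) w) - ∫ w in x 0..x n, g (a 0) w| ≤
      ε * ∑ i ∈ Finset.range n, ‖a (i + 1) - a i‖ := by
    have : ∀ k ≤ n, |(∫ w in x 0..x n, g (a k) w) - ∫ w in x 0..x n, g (a 0) w| ≤
      ε * ∑ i ∈ Finset.range k, ‖a (i + 1) - a i‖ := by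
      intro k
      induction k with
      | zero => intro _; simp
      | succ k ih =>
        intro hk
        have h3 := ih (by omega)
        have h4 := hchange _ (ha (k + 1) hk) _ (ha k (by omega)) _ (hx n le_rfl)
        rw [Finset.sum_range_succ]
        rw [abs_le] at h3 h4 ⊢
        constructor <;> linarith [h3.1, h3.2, h4.1, h4.2]
    exact this n le_rfl
  rw [abs_le] at h0 h1 h2 ⊢
  constructor <;> linarith [h0.1, h0.2, h1.1, h1.2, h2.1, h2.2]

/-- A two-parameter remainder on `[0, T]` which is of smaller order than
`(S v - S u) ^ 2 + (K v - K u)`, uniformly over grid points `u` and later times `v`. -/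
def Negligible (G : GridSeq) (S K : ℝ → ℝ) (T : ℝ) (R : ℝ → ℝ → ℝ) : Prop :=
  ∀ ε > 0, ∃ δ > 0, ∀ u v, u ∈ G.points → 0 ≤ u → u ≤ v → v ≤ T → v ≤ u + δ →
    |R u v| ≤ ε * ((S v - S u) ^ 2 + (K v - K u))

theorem exists_monotone_control {n : ℕ} {A : ℝ → Fin n → ℝ} {T : ℝ} (hT : 0 < T)
    (hA : ∀ k, BoundedVariationOn (fun t => A t k) (Set.Icc 0 T)) :
    ∃ K : ℝ → ℝ, MonotoneOn K (Set.Icc 0 T) ∧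
      ∀ u v, 0 ≤ u → u ≤ v → v ≤ T → ‖A v - A u‖ ≤ K v - K u := by
  have h0 : (0 : ℝ) ∈ Set.Icc 0 T := ⟨le_rfl, hT.le⟩
  have hm := fun k => variationOnFromTo.monotoneOn (hA k).locallyBoundedVariationOn h0
  have hmono : MonotoneOn
      (fun t => ∑ k, variationOnFromTo (fun t => A t k) (Set.Icc 0 T) 0 t) (Set.Icc 0 T) :=
    fun u hu v hv huv => Finset.sum_le_sum fun k _ => hm k hu hv huv
  refine ⟨_, hmono, fun u v hu huv hv => ?_⟩
  have hu' : u ∈ Set.Icc 0 T := ⟨hu, huv.trans hv⟩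
  have hv' : v ∈ Set.Icc 0 T := ⟨hu.trans huv, hv⟩
  refine (pi_norm_le_iff_of_nonneg (sub_nonneg.2 (hmono hu' hv' huv))).2 fun k => ?_
  rw [← Finset.sum_sub_distrib]
  have hk : ‖A v k - A u k‖ ≤ variationOnFromTo (fun t => A t k) (Set.Icc 0 T) 0 v -
      variationOnFromTo (fun t => A t k) (Set.Icc 0 T) 0 u := by
    have hadd := variationOnFromTo.add (hA k).locallyBoundedVariationOn h0 hu' hv'
    rw [← hadd, add_sub_cancel_left, variationOnFromTo.eq_of_le _ _ huv, ← dist_eq_norm,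
      ← ENNReal.ofReal_le_iff_le_toReal ((hA k).locallyBoundedVariationOn u v hu' hv'),
      ← edist_dist]
    exact eVariationOn.edist_le _ ⟨hv', huv, le_rfl⟩ ⟨hu', le_rfl, huv⟩
  exact hk.trans (Finset.single_le_sum
    (f := fun k => variationOnFromTo (fun t => A t k) (Set.Icc 0 T) 0 v -
      variationOnFromTo (fun t => A t k) (Set.Icc 0 T) 0 u)
    (fun k _ => sub_nonneg.2 (hm k hu' hv' huv)) (Finset.mem_univ k))

theorem Admissible.continuousOn {S ξ : ℝ → ℝ} (hξ : Admissible S ξ)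
    (hS : ContinuousOn S (Set.Ici 0)) {T : ℝ} (hT : 0 < T) : ContinuousOn ξ (Set.Icc 0 T) := by
  obtain ⟨n, g, A, hg, hA, hξg⟩ := hξ T hT
  have hAc : ContinuousOn A (Set.Icc 0 T) := continuousOn_pi.2 fun k => (hA k).1
  exact (hg.continuous.comp_continuousOn
    (hAc.prodMk (hS.mono Set.Icc_subset_Ici_self))).congr hξg

/-- Second order expansion of the pathwise Itô integral of an admissible integrand. -/
theorem exists_expansion_integral {G : GridSeq} {S Q ξ I : ℝ → ℝ} {T : ℝ} (hT : 0 < T)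
    (hS : ContinuousOn S (Set.Ici 0)) (hQ : HasQV G S Q) (hξ : Admissible S ξ)
    (hI : ∀ t ≥ 0, ConvTo G (fun u v => ξ u * (S v - S u)) t (I t)) :
    ∃ p K : ℝ → ℝ, ContinuousOn p (Set.Icc 0 T) ∧ MonotoneOn K (Set.Icc 0 T) ∧
      (∀ u v, 0 ≤ u → u ≤ v → v ≤ T → Q v - Q u ≤ K v - K u) ∧
      Negligible G S K T (fun u v => I v - I u - ξ u * (S v - S u) -
        p u * ((S v - S u) ^ 2 - (Q v - Q u))) := by
  obtain ⟨n, g, A, hg, hA, hξg⟩ := hξ T hT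
  obtain ⟨κ, hκm, hκ⟩ := exists_monotone_control hT fun k => (hA k).2
  have hAc : ContinuousOn A (Set.Icc 0 T) := continuousOn_pi.2 fun k => (hA k).1
  have hST : ContinuousOn S (Set.Icc 0 T) := hS.mono Set.Icc_subset_Ici_self
  have hPc : ContinuousOn (fun t => (A t, S t)) (Set.Icc 0 T) := hAc.prodMk hST
  let g' : (Fin n → ℝ) → ℝ → ℝ := fun a y => fderiv ℝ (Function.uncurry g) (a, y) (0, 1)
  have hg'c : Continuous (fun z : (Fin n → ℝ) × ℝ => g' z.1 z.2) :=
    (hg.continuous_fderiv one_ne_zero).clm_apply continuous_const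
  have hderiv : ∀ a y, HasDerivAt (g a) (g' a y) y := fun a y =>
    (hg.differentiable one_ne_zero (a, y)).hasFDerivAt.comp_hasDerivAt y
      ((hasDerivAt_const y a).prodMk (hasDerivAt_id y))
  obtain ⟨R, hR⟩ := isCompact_Icc.exists_bound_of_continuousOn hPc
  have hbox : IsCompact (Metric.closedBall (0 : (Fin n → ℝ) × ℝ) R) := isCompact_closedBall _ _
  obtain ⟨L, hL⟩ := hbox.exists_bound_of_continuousOn
    (hg.continuous_fderiv one_ne_zero).continuousOn
  have hmem : ∀ t ∈ Set.Icc 0 T, (A t, S t) ∈ Metric.closedBall (0 : (Fin n → ℝ) × ℝ) R :=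
    fun t ht => mem_closedBall_zero_iff.2 (hR t ht)
  have hL0 : 0 ≤ L := (norm_nonneg _).trans (hL _ (hmem 0 ⟨le_rfl, hT.le⟩))
  refine ⟨fun t => g' (A t) (S t) / 2, fun t => Q t + κ t,
    (hg'c.comp_continuousOn hPc).div_const 2,
    fun u hu v hv huv => add_le_add (hQ.mono hu.1 huv) (hκm hu hv huv),
    fun u v hu huv hv => by
      have := hκm ⟨hu, huv.trans hv⟩ ⟨hu.trans huv, hv⟩ huv
      simp only
      linarith,
    fun ε hε => ?_⟩
  obtain ⟨η, hη, hηuc⟩ := Metric.uniformContinuousOn_iff.1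
    (hbox.uniformContinuousOn_of_continuous hg'c.continuousOn) (ε / 2) (by positivity)
  set ρ := min (η / 2) (ε / 2 / (L + 1)) with hρ
  have hρ0 : 0 < ρ := by positivity
  obtain ⟨δ, hδ, hmod⟩ := exists_modulus hPc hρ0
  refine ⟨δ, hδ, fun u v hu hu0 huv hvT hvδ => ?_⟩
  obtain ⟨N, s, hs0, hsm, hsv, -, hslim, hsum⟩ := G.exists_refinement hu huv
  have hsmem : ∀ k, ∀ i ≤ N k, u ≤ s k i ∧ s k i ≤ v := fun k i hi =>
    ⟨hs0 k ▸ (hsm k).monotone (Nat.zero_le i), ((hsm k).monotone hi).trans (hsv k)⟩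
  have huT : u ≤ T := huv.trans hvT
  have hkey : ∀ k, |∑ i ∈ Finset.range (N k), ξ (s k i) * (S (s k (i + 1)) - S (s k i)) -
      ξ u * (S (s k (N k)) - S u) - g' (A u) (S u) / 2 * ((S (s k (N k)) - S u) ^ 2 -
        ∑ i ∈ Finset.range (N k), (S (s k (i + 1)) - S (s k i)) ^ 2)| ≤
      ε / 2 * ((S (s k (N k)) - S u) ^ 2 +
        ∑ i ∈ Finset.range (N k), (S (s k (i + 1)) - S (s k i)) ^ 2 +
        2 * (κ v - κ u)) := by
    intro k
    have hJ : (Set.Icc (-R) R ∩ Set.Icc (S u - ρ) (S u + ρ)).OrdConnected :=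
      Set.ordConnected_Icc.inter Set.ordConnected_Icc
    have hclose : ∀ i ≤ N k, ‖A (s k i)‖ ≤ R ∧ |S (s k i)| ≤ R ∧
        ‖A (s k i) - A u‖ ≤ ρ ∧ |S (s k i) - S u| ≤ ρ := by
      intro i hi
      obtain ⟨h1, h2⟩ := hsmem k i hi
      have h3 := hR (s k i) ⟨hu0.trans h1, h2.trans hvT⟩
      have h4 := hmod u (s k i) hu0 h1 (h2.trans hvT) (h2.trans hvδ)
      rw [Prod.norm_def, max_le_iff] at h3
      rw [dist_eq_norm, Prod.norm_def, max_le_iff] at h4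
      exact ⟨h3.1, h3.2, h4.1, h4.2⟩
    have hin : ∀ b ∈ Metric.closedBall (0 : Fin n → ℝ) R ∩ Metric.closedBall (A u) ρ,
        ∀ y ∈ Set.Icc (-R) R ∩ Set.Icc (S u - ρ) (S u + ρ),
        (b, y) ∈ Metric.closedBall (0 : (Fin n → ℝ) × ℝ) R := by
      intro b hb y hy
      rw [mem_closedBall_zero_iff, Prod.norm_def, max_le_iff]
      exact ⟨mem_closedBall_zero_iff.1 hb.1, abs_le.2 hy.1⟩
    have hT := abs_riemannSum_sub_le hderiv hJ (q := g' (A u) (S u)) (L := L) (ε := ε / 2)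
      (x := fun i => S (s k i)) (a := fun i => A (s k i)) (n := N k)
      (D := Metric.closedBall 0 R ∩ Metric.closedBall (A u) ρ)
      (fun i hi => by
        obtain ⟨h1, h2, h3, h4⟩ := hclose i hi
        rw [abs_le] at h2 h4
        exact ⟨h2, by linarith [h4.1], by linarith [h4.2]⟩)
      (fun i hi => by
        obtain ⟨h1, h2, h3, h4⟩ := hclose i hi
        exact ⟨mem_closedBall_zero_iff.2 h1, mem_closedBall_iff_norm.2 h3⟩)
      (fun b hb y hy => by
        refine (hηuc _ (hin b hb y hy) _ (hmem u ⟨hu0, huT⟩) ?_).le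
        rw [dist_eq_norm, Prod.norm_def]
        have h1 : ‖b - A u‖ ≤ ρ := mem_closedBall_iff_norm.1 hb.2
        have h2 : |y - S u| ≤ ρ := abs_le.2 ⟨by linarith [hy.2.1], by linarith [hy.2.2]⟩
        have h3 : ρ ≤ η / 2 := min_le_left _ _
        exact max_lt (by simpa using by linarith) (by simpa using by linarith))
      (fun b hb c hc y hy => by
        have := Convex.norm_image_sub_le_of_norm_fderiv_le (𝕜 := ℝ)
          (fun z _ => hg.differentiable one_ne_zero z) hL (convex_closedBall _ _)
          (hin c hc y hy) (hin b hb y hy)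
        refine this.trans_eq ?_
        simp [Prod.norm_def])
      (fun y hy => by
        have h2 : |y - S u| ≤ ρ := abs_le.2 ⟨by linarith [hy.2.1], by linarith [hy.2.2]⟩
        have h3 : ρ ≤ ε / 2 / (L + 1) := min_le_right _ _
        rw [hs0]
        calc L * |y - S u| ≤ (L + 1) * (ε / 2 / (L + 1)) := by gcongr; linarith; linarith
          _ = ε / 2 := by field_simp)
    have hvar : ∑ i ∈ Finset.range (N k), ‖A (s k (i + 1)) - A (s k i)‖ ≤ κ v - κ u := by
      have h1 : ∑ i ∈ Finset.range (N k), ‖A (s k (i + 1)) - A (s k i)‖ ≤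
          ∑ i ∈ Finset.range (N k), (κ (s k (i + 1)) - κ (s k i)) := by
        refine Finset.sum_le_sum fun i hi => ?_
        have hi' := Finset.mem_range.1 hi
        exact hκ _ _ (hu0.trans (hsmem k i (by omega)).1) ((hsm k).monotone (by omega))
          ((hsmem k (i + 1) (by omega)).2.trans hvT)
      rw [Finset.sum_range_sub (fun i => κ (s k i)), hs0] at h1
      obtain ⟨h2, h3⟩ := hsmem k (N k) le_rfl
      linarith [hκm ⟨hu0.trans h2, h3.trans hvT⟩ ⟨hu0.trans huv, hvT⟩ h3]
    simp only [hs0] at hT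
    have hξs : ∑ i ∈ Finset.range (N k), ξ (s k i) * (S (s k (i + 1)) - S (s k i)) =
        ∑ i ∈ Finset.range (N k), g (A (s k i)) (S (s k i)) * (S (s k (i + 1)) - S (s k i)) := by
      refine Finset.sum_congr rfl fun i hi => ?_
      obtain ⟨h1, h2⟩ := hsmem k i (Finset.mem_range.1 hi).le
      rw [hξg _ ⟨hu0.trans h1, h2.trans hvT⟩]
    rw [hξs, hξg u ⟨hu0, huT⟩]
    refine hT.trans ?_
    gcongr
  have hv0 : 0 ≤ v := hu0.trans huv
  have hlimS : Tendsto (fun k => S (s k (N k))) atTop (𝓝 (S v)) :=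
    (hS v hv0).tendsto.comp (tendsto_nhdsWithin_iff.2
      ⟨hslim, Eventually.of_forall fun k => hu0.trans (hsmem k (N k) le_rfl).1⟩)
  have hlimQ := hsum _ _ _ (hQ.2.2 u) (hQ.2.2 v)
  have hlimI := hsum _ _ _ (hI u hu0) (hI v hv0)
  have hΔ := hlimS.sub_const (S u)
  have hlim := le_of_tendsto_of_tendsto'
    ((hlimI.sub (hΔ.const_mul (ξ u))).sub
      (((hΔ.pow 2).sub hlimQ).const_mul (g' (A u) (S u) / 2))).abs
    ((((hΔ.pow 2).add hlimQ).add_const (2 * (κ v - κ u))).const_mul (ε / 2)) hkey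
  refine hlim.trans ?_
  have hQm := hQ.mono hu0 huv
  have := mul_nonneg hε.le (sq_nonneg (S v - S u))
  have := mul_nonneg hε.le (sub_nonneg.2 hQm)
  simp only
  linarith

theorem GridSeq.continuousOn_of_small_increments (G : GridSeq) {X : ℝ → ℝ} {T : ℝ}
    (h : ∀ ε > 0, ∃ δ > 0, ∀ u v, u ∈ G.points → 0 ≤ u → u ≤ v → v ≤ T → v ≤ u + δ →
      |X v - X u| ≤ ε) : ContinuousOn X (Set.Icc 0 T) := by
  have hle : ∀ ε > 0, ∃ δ > 0, ∀ s t, 0 ≤ s → s ≤ t → t ≤ T → t ≤ s + δ → |X t - X s| ≤ ε := by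
    intro ε hε
    obtain ⟨δ, hδ, hX⟩ := h (ε / 2) (by positivity)
    refine ⟨δ / 2, by positivity, fun s t hs hst ht hd => ?_⟩
    obtain ⟨n, p, -, -, h1, h2, hp, -⟩ := G.exists_partition (half_pos hδ) hs
    have h0 := G.points_nonneg (hp n)
    have h3 := hX _ s (hp n) h0 h1 (hst.trans ht) (by linarith)
    have h4 := hX _ t (hp n) h0 (h1.trans hst) ht (by linarith)
    rw [abs_le] at h3 h4 ⊢
    constructor <;> linarith [h3.1, h3.2, h4.1, h4.2]
  rw [Metric.continuousOn_iff]
  intro s hs ε hε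
  obtain ⟨δ, hδ, hX⟩ := hle (ε / 2) (by positivity)
  refine ⟨δ, hδ, fun t ht hd => ?_⟩
  rw [Real.dist_eq] at hd ⊢
  rcases le_total s t with hst | hst
  · have := hX s t hs.1 hst ht.2 (by linarith [le_abs_self (t - s)])
    linarith
  · have := hX t s ht.1 hst hs.2 (by linarith [neg_abs_le (t - s)])
    rw [abs_sub_comm]
    linarith

theorem continuousOn_of_expansion {G : GridSeq} {S Q X b p K : ℝ → ℝ} {T : ℝ} (hT : 0 < T)
    (hS : ContinuousOn S (Set.Ici 0)) (hQ : HasQV G S Q)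
    (hb : ContinuousOn b (Set.Icc 0 T)) (hp : ContinuousOn p (Set.Icc 0 T))
    (hK : MonotoneOn K (Set.Icc 0 T))
    (hX : Negligible G S K T (fun u v => X v - X u - b u * (S v - S u) -
        p u * ((S v - S u) ^ 2 - (Q v - Q u)))) : ContinuousOn X (Set.Icc 0 T) := by
  obtain ⟨M₁, hM₁, hb⟩ := exists_abs_le hb
  obtain ⟨M₂, hM₂, hp⟩ := exists_abs_le hp
  have hK0 : 0 ≤ K T - K 0 := sub_nonneg.2 (hK ⟨le_rfl, hT.le⟩ ⟨hT.le, le_rfl⟩ hT.le)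
  refine G.continuousOn_of_small_increments fun ε hε => ?_
  set M := M₁ + 2 * M₂ + 1 + (K T - K 0) with hM
  have hM0 : 0 < M := by positivity
  set a := min 1 (ε / M) with ha
  have ha0 : 0 < a := by positivity
  obtain ⟨δ₁, hδ₁, h₁⟩ := exists_modulus (hS.mono Set.Icc_subset_Ici_self) (T := T) ha0
  obtain ⟨δ₂, hδ₂, h₂⟩ := exists_modulus (hQ.1.mono Set.Icc_subset_Ici_self) (T := T) ha0
  obtain ⟨δ₃, hδ₃, h₃⟩ := hX a ha0
  refine ⟨min δ₁ (min δ₂ δ₃), by positivity, fun u v hu hu0 huv hvT hd => ?_⟩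
  have d1 := min_le_left δ₁ (min δ₂ δ₃)
  have d2 := (min_le_right δ₁ (min δ₂ δ₃)).trans (min_le_left _ _)
  have d3 := (min_le_right δ₁ (min δ₂ δ₃)).trans (min_le_right _ _)
  replace h₁ := h₁ u v hu0 huv hvT (by linarith)
  replace h₂ := h₂ u v hu0 huv hvT (by linarith)
  replace h₃ := h₃ u v hu hu0 huv hvT (by linarith)
  rw [Real.dist_eq] at h₁ h₂
  have ha1 : a ≤ 1 := min_le_left _ _
  have hsq : (S v - S u) ^ 2 ≤ a := by
    rw [← sq_abs]
    calc |S v - S u| ^ 2 ≤ a ^ 2 := by gcongr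
      _ ≤ a := by nlinarith
  have e1 : |b u * (S v - S u)| ≤ M₁ * a := by
    rw [abs_mul]; gcongr; exact hb u hu0 (huv.trans hvT)
  have e2 : |p u * ((S v - S u) ^ 2 - (Q v - Q u))| ≤ M₂ * (2 * a) := by
    rw [abs_mul]
    gcongr
    · exact hp u hu0 (huv.trans hvT)
    · rw [abs_le] at h₂ ⊢
      constructor <;> linarith [h₂.1, h₂.2, sq_nonneg (S v - S u)]
  have e3 : a * ((S v - S u) ^ 2 + (K v - K u)) ≤ a * (1 + (K T - K 0)) := by
    gcongr
    · linarith
    · exact hK ⟨hu0.trans huv, hvT⟩ ⟨hT.le, le_rfl⟩ hvT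
    · exact hK ⟨le_rfl, hT.le⟩ ⟨hu0, huv.trans hvT⟩ hu0
  have e4 : a * M ≤ ε := by
    calc a * M ≤ ε / M * M := by gcongr; exact min_le_right _ _
      _ = ε := by field_simp
  rw [abs_le] at h₃ e1 e2 ⊢
  constructor <;> linarith [h₃.1, h₃.2, e1.1, e1.2, e2.1, e2.2]

/-- Primitives are a.e. strongly measurable, even where the integral takes its default value. -/
theorem aestronglyMeasurable_primitive (f : ℝ → ℝ) (T : ℝ) :
    AEStronglyMeasurable (fun t => ∫ s in (0 : ℝ)..t, f s) (volume.restrict (Set.Icc 0 T)) := by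
  set P : Set ℝ := {t | t ∈ Set.Icc 0 T ∧ IntervalIntegrable f volume 0 t} with hP
  have hPsub : P ⊆ Set.Icc 0 T := fun t ht => ht.1
  have hPord : P.OrdConnected := ⟨fun x hx y hy z hz =>
    ⟨⟨hx.1.1.trans hz.1, hz.2.trans hy.1.2⟩, hy.2.mono_set (by
      rw [Set.uIcc_of_le (hx.1.1.trans hz.1), Set.uIcc_of_le hy.1.1]
      exact Set.Icc_subset_Icc_right hz.2)⟩⟩
  have hcont : ∀ t ∈ P, ContinuousOn (fun t => ∫ s in (0 : ℝ)..t, f s) (Set.Icc 0 t) := by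
    intro t ht
    have := intervalIntegral.continuousOn_primitive_interval' ht.2 Set.left_mem_uIcc
    rwa [Set.uIcc_of_le ht.1.1] at this
  have hJP : ContinuousOn (fun t => ∫ s in (0 : ℝ)..t, f s) P := by
    intro t ht
    by_cases h : ∃ t' ∈ P, t < t'
    · obtain ⟨t', ht', htt'⟩ := h
      refine (hcont t' ht' t ⟨ht.1.1, htt'.le⟩).mono_of_mem_nhdsWithin ?_
      filter_upwards [self_mem_nhdsWithin, mem_nhdsWithin_of_mem_nhds (Iio_mem_nhds htt')]
        with x hx hx'
      exact ⟨hx.1.1, le_of_lt hx'⟩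
    · push Not at h
      exact (hcont t ht t ⟨ht.1.1, le_rfl⟩).mono fun x hx => ⟨hx.1.1, h x hx⟩
  rw [← Set.union_sdiff_cancel hPsub, aestronglyMeasurable_union_iff]
  refine ⟨hJP.aestronglyMeasurable hPord.measurableSet, ?_⟩
  refine (aestronglyMeasurable_const (b := (0 : ℝ))).congr ?_
  filter_upwards [self_mem_ae_restrict (measurableSet_Icc.diff hPord.measurableSet)] with t ht
  exact (intervalIntegral.integral_undef fun h => ht.2 ⟨ht.1, h⟩).symm

theorem continuousOn_primitive {f : ℝ → ℝ} {T : ℝ} (hT : 0 ≤ T)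
    (hf : IntervalIntegrable f volume 0 T) :
    ContinuousOn (fun t => ∫ s in (0 : ℝ)..t, f s) (Set.Icc 0 T) := by
  have := intervalIntegral.continuousOn_primitive_interval' hf Set.left_mem_uIcc
  rwa [Set.uIcc_of_le hT] at this

theorem SelfFinancing.continuousOn_value {G : GridSeq} {S r B ξ η V : ℝ → ℝ} {T : ℝ}
    (h : SelfFinancing G S B r ξ η V) (hT : 0 < T) (hS : ContinuousOn S (Set.Ici 0))
    (hr : IntervalIntegrable r volume 0 T) (hB : ContinuousOn B (Set.Icc 0 T))
    {I : ℝ → ℝ} (hI : ContinuousOn I (Set.Icc 0 T))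
    (hV : ∀ t ≥ 0, V t = V 0 + I t + ∫ s in (0 : ℝ)..t, η s * r s * B s) :
    ContinuousOn V (Set.Icc 0 T) ∧
      IntervalIntegrable (fun s => η s * r s * B s) volume 0 T := by
  obtain ⟨hadm, hηr, hval, -⟩ := h
  have hmeas : ∀ {f : ℝ → ℝ}, ContinuousOn f (Set.Icc 0 T) →
      AEStronglyMeasurable f (volume.restrict (Set.Icc 0 T)) := fun hf =>
    hf.aestronglyMeasurable measurableSet_Icc
  have hVm : AEStronglyMeasurable V (volume.restrict (Set.Icc 0 T)) := by
    refine ((hmeas ((continuousOn_const (c := V 0)).add hI)).add (aestronglyMeasurable_primitive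
      (fun s => η s * r s * B s) T)).congr ?_
    filter_upwards [self_mem_ae_restrict measurableSet_Icc] with t ht
    exact (hV t ht.1).symm
  have hξ := hadm.continuousOn hS hT
  have hS' : ContinuousOn S (Set.Icc 0 T) := hS.mono Set.Icc_subset_Ici_self
  have hrI := (intervalIntegrable_iff_integrableOn_Icc_of_le hT.le).1 hr
  have hfm : AEStronglyMeasurable (fun s => η s * r s * B s)
      (volume.restrict (Set.Icc 0 T)) := by
    refine ((hVm.sub (hmeas (hξ.mul hS'))).mul hrI.aestronglyMeasurable).congr
      (Eventually.of_forall fun s => ?_)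
    simp only [Pi.mul_apply, Pi.sub_apply, hval s]
    ring
  obtain ⟨M, hM, hBM⟩ := exists_abs_le hB
  have hint : IntervalIntegrable (fun s => η s * r s * B s) volume 0 T := by
    rw [intervalIntegrable_iff_integrableOn_Icc_of_le hT.le]
    have h1 := (intervalIntegrable_iff_integrableOn_Icc_of_le hT.le).1 (hηr T hT)
    refine (h1.mul_const M).mono' hfm ?_
    filter_upwards [self_mem_ae_restrict measurableSet_Icc] with t ht
    rw [norm_mul, Real.norm_eq_abs, Real.norm_eq_abs]
    gcongr
    exact hBM t ht.1 ht.2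
  exact ⟨((continuousOn_const.add hI).add (continuousOn_primitive hT.le hint)).congr
    fun t ht => hV t ht.1, hint⟩

theorem Negligible.add {G : GridSeq} {S K : ℝ → ℝ} {T : ℝ} {R R' : ℝ → ℝ → ℝ}
    (h : Negligible G S K T R) (h' : Negligible G S K T R') :
    Negligible G S K T (fun u v => R u v + R' u v) := by
  intro ε hε
  obtain ⟨δ, hδ, h⟩ := h (ε / 2) (by positivity)
  obtain ⟨δ', hδ', h'⟩ := h' (ε / 2) (by positivity)
  refine ⟨min δ δ', by positivity, fun u v hu h0 huv hv hd => ?_⟩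
  have h1 := h u v hu h0 huv hv (by linarith [min_le_left δ δ'])
  have h2 := h' u v hu h0 huv hv (by linarith [min_le_right δ δ'])
  exact (abs_add_le _ _).trans (by linarith)

theorem Negligible.bdd_mul {G : GridSeq} {S K : ℝ → ℝ} {T : ℝ} {R β : ℝ → ℝ → ℝ} {M : ℝ}
    (h : Negligible G S K T R) (hM : 0 < M)
    (hβ : ∀ u v, 0 ≤ u → u ≤ v → v ≤ T → |β u v| ≤ M) :
    Negligible G S K T (fun u v => β u v * R u v) := by
  intro ε hε
  obtain ⟨δ, hδ, h⟩ := h (ε / M) (by positivity)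
  refine ⟨δ, hδ, fun u v hu h0 huv hv hd => ?_⟩
  rw [abs_mul]
  calc |β u v| * |R u v| ≤ M * (ε / M * ((S v - S u) ^ 2 + (K v - K u))) := by
        gcongr
        · exact hβ u v h0 huv hv
        · exact h u v hu h0 huv hv hd
    _ = ε * ((S v - S u) ^ 2 + (K v - K u)) := by field_simp

theorem Negligible.mono {G : GridSeq} {S K K' : ℝ → ℝ} {T : ℝ} {R : ℝ → ℝ → ℝ}
    (h : Negligible G S K T R)
    (hK : ∀ u v, 0 ≤ u → u ≤ v → v ≤ T → K v - K u ≤ K' v - K' u) :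
    Negligible G S K' T R := by
  intro ε hε
  obtain ⟨δ, hδ, h⟩ := h ε hε
  refine ⟨δ, hδ, fun u v hu h0 huv hv hd => (h u v hu h0 huv hv hd).trans ?_⟩
  gcongr ε * (_ + ?_)
  exact hK u v h0 huv hv

theorem Negligible.congr {G : GridSeq} {S K : ℝ → ℝ} {T : ℝ} {R R' : ℝ → ℝ → ℝ}
    (h : Negligible G S K T R) (hR : ∀ u v, 0 ≤ u → u ≤ v → v ≤ T → R' u v = R u v) :
    Negligible G S K T R' := by
  intro ε hε
  obtain ⟨δ, hδ, h⟩ := h ε hε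
  exact ⟨δ, hδ, fun u v hu h0 huv hv hd => (hR u v h0 huv hv).symm ▸ h u v hu h0 huv hv hd⟩

theorem intervalIntegrable_of_subset {f : ℝ → ℝ} {T u v : ℝ} (hf : IntervalIntegrable f volume 0 T)
    (hu : 0 ≤ u) (huv : u ≤ v) (hv : v ≤ T) : IntervalIntegrable f volume u v :=
  hf.mono_set (by
    rw [Set.uIcc_of_le huv, Set.uIcc_of_le ((hu.trans huv).trans hv)]
    exact Set.Icc_subset_Icc hu hv)

theorem primitive_sub {f : ℝ → ℝ} {T u v : ℝ} (hf : IntervalIntegrable f volume 0 T)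
    (hu : 0 ≤ u) (huv : u ≤ v) (hv : v ≤ T) :
    (∫ s in (0 : ℝ)..v, f s) - ∫ s in (0 : ℝ)..u, f s = ∫ s in u..v, f s :=
  intervalIntegral.integral_interval_sub_left
    (intervalIntegrable_of_subset hf le_rfl (hu.trans huv) hv)
    (intervalIntegrable_of_subset hf le_rfl hu (huv.trans hv))

theorem abs_primitive_sub_le {r : ℝ → ℝ} {T u v : ℝ} (hr : IntervalIntegrable r volume 0 T)
    (hu : 0 ≤ u) (huv : u ≤ v) (hv : v ≤ T) :
    |(∫ s in (0 : ℝ)..v, r s) - ∫ s in (0 : ℝ)..u, r s| ≤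
      (∫ s in (0 : ℝ)..v, |r s|) - ∫ s in (0 : ℝ)..u, |r s| := by
  rw [primitive_sub hr hu huv hv, primitive_sub hr.abs hu huv hv]
  exact intervalIntegral.abs_integral_le_integral_abs huv

theorem negligible_drift (G : GridSeq) (S : ℝ → ℝ) {Y r : ℝ → ℝ} {T : ℝ}
    (hY : ContinuousOn Y (Set.Icc 0 T)) (hr : IntervalIntegrable r volume 0 T)
    (hYr : IntervalIntegrable (fun s => Y s * r s) volume 0 T) :
    Negligible G S (fun t => ∫ s in (0 : ℝ)..t, |r s|) T (fun u v =>
      (∫ s in (0 : ℝ)..v, Y s * r s) - (∫ s in (0 : ℝ)..u, Y s * r s) -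
        Y u * ((∫ s in (0 : ℝ)..v, r s) - ∫ s in (0 : ℝ)..u, r s)) := by
  intro ε hε
  obtain ⟨δ, hδ, h⟩ := exists_modulus hY hε
  refine ⟨δ, hδ, fun u v _ hu huv hv hd => ?_⟩
  have hri := intervalIntegrable_of_subset hr hu huv hv
  beta_reduce
  rw [primitive_sub hYr hu huv hv, primitive_sub hr hu huv hv, primitive_sub hr.abs hu huv hv,
    ← intervalIntegral.integral_const_mul, ← intervalIntegral.integral_sub
      (intervalIntegrable_of_subset hYr hu huv hv) (hri.const_mul _)]
  have h1 := intervalIntegral.norm_integral_le_of_norm_le (μ := volume) huv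
    (f := fun s => Y s * r s - Y u * r s) (g := fun s => ε * |r s|)
    (Eventually.of_forall fun s hs => by
      rw [← sub_mul, norm_mul, Real.norm_eq_abs, Real.norm_eq_abs]
      gcongr
      exact h u s hu hs.1.le (hs.2.trans hv) (hs.2.trans hd)) (hri.abs.const_mul ε)
  rw [intervalIntegral.integral_const_mul] at h1
  refine h1.trans ?_
  have := mul_nonneg hε.le (sq_nonneg (S v - S u))
  linarith

theorem negligible_exp_primitive (G : GridSeq) (S : ℝ → ℝ) {r B : ℝ → ℝ} {T : ℝ} (hT : 0 < T)
    (hr : IntervalIntegrable r volume 0 T)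
    (hB : ∀ t, B t = Real.exp (∫ s in (0 : ℝ)..t, r s)) (hBc : ContinuousOn B (Set.Icc 0 T)) :
    Negligible G S (fun t => ∫ s in (0 : ℝ)..t, |r s|) T (fun u v =>
      B v - B u - B u * ((∫ s in (0 : ℝ)..v, r s) - ∫ s in (0 : ℝ)..u, r s)) := by
  obtain ⟨M, hM, hBM⟩ := exists_abs_le hBc
  intro ε hε
  obtain ⟨δ, hδ, h⟩ := exists_modulus (continuousOn_primitive hT.le hr)
    (ε := min 1 (ε / M)) (by positivity)
  refine ⟨δ, hδ, fun u v _ hu huv hv hd => ?_⟩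
  replace h := h u v hu huv hv hd
  rw [Real.dist_eq] at h
  beta_reduce
  have hΛ := abs_primitive_sub_le hr hu huv hv
  set x := (∫ s in (0 : ℝ)..v, r s) - ∫ s in (0 : ℝ)..u, r s with hx
  have hBv : B v = B u * Real.exp x := by
    rw [hB, hB, ← Real.exp_add, hx]; congr 1; ring
  have hfac : B v - B u - B u * x = B u * (Real.exp x - 1 - x) := by rw [hBv]; ring
  rw [hfac, abs_mul]
  calc |B u| * |Real.exp x - 1 - x| ≤ M * x ^ 2 := by
        gcongr
        · exact hBM u hu (huv.trans hv)
        · exact Real.abs_exp_sub_one_sub_id_le (h.trans (min_le_left _ _))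
    _ = M * |x| * |x| := by rw [mul_assoc, abs_mul_abs_self]; ring
    _ ≤ M * (ε / M) * ((∫ s in (0 : ℝ)..v, |r s|) - ∫ s in (0 : ℝ)..u, |r s|) := by
        gcongr
        exact h.trans (min_le_right _ _)
    _ = ε * ((∫ s in (0 : ℝ)..v, |r s|) - ∫ s in (0 : ℝ)..u, |r s|) := by field_simp
    _ ≤ _ := by
        gcongr
        linarith [sq_nonneg (S v - S u)]

/-- The cushion of a self-financing strategy with `ξ = m X / S` solves a linear equation. -/
theorem SelfFinancing.exists_expansion_cushion {G : GridSeq} {S Q r B m ξ η V X : ℝ → ℝ}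
    {T c : ℝ} (h : SelfFinancing G S B r ξ η V) (hT : 0 < T) (hS : ContinuousOn S (Set.Ici 0))
    (hSpos : ∀ t ∈ Set.Ici (0 : ℝ), 0 < S t) (hQ : HasQV G S Q)
    (hr : IntervalIntegrable r volume 0 T)
    (hB : ∀ t, B t = Real.exp (∫ s in (0 : ℝ)..t, r s))
    (hX : ∀ t, X t = V t - c * B t) (hξ : ∀ t ≥ 0, ξ t = m t * X t / S t) :
    ∃ p K : ℝ → ℝ, ContinuousOn p (Set.Icc 0 T) ∧ MonotoneOn K (Set.Icc 0 T) ∧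
      (∀ u v, 0 ≤ u → u ≤ v → v ≤ T → Q v - Q u ≤ K v - K u) ∧
      ContinuousOn X (Set.Icc 0 T) ∧
      Negligible G S K T (fun u v => X v - X u - X u * (m u / S u * (S v - S u) +
        (1 - m u) * ((∫ s in (0 : ℝ)..v, r s) - ∫ s in (0 : ℝ)..u, r s)) -
          p u * ((S v - S u) ^ 2 - (Q v - Q u))) := by
  have hadm := h.1
  have hval := h.2.2.1
  have hI := h.2.2.2
  choose! I hI hV using hI
  obtain ⟨p, K, hp, hK, hQK, hneg⟩ := exists_expansion_integral hT hS hQ hadm hI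
  have hξc := hadm.continuousOn hS hT
  have hIc := continuousOn_of_expansion hT hS hQ hξc hp hK hneg
  have hBc : ContinuousOn B (Set.Icc 0 T) :=
    (Real.continuous_exp.comp_continuousOn (continuousOn_primitive hT.le hr)).congr
      fun t _ => hB t
  obtain ⟨hVc, hint⟩ := h.continuousOn_value hT hS hr hBc hIc hV
  have hXc : ContinuousOn X (Set.Icc 0 T) :=
    (hVc.sub (hBc.const_mul c)).congr fun t _ => hX t
  have hYc : ContinuousOn (fun t => V t - ξ t * S t) (Set.Icc 0 T) :=
    hVc.sub (hξc.mul (hS.mono Set.Icc_subset_Ici_self))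
  have hfun : (fun s => η s * r s * B s) = fun s => (V s - ξ s * S s) * r s := by
    funext s; rw [hval s]; ring
  rw [hfun] at hint
  simp only [hfun] at hV
  set Λ : ℝ → ℝ := fun t => ∫ s in (0 : ℝ)..t, |r s| with hΛ
  have hΛm : ∀ u v, 0 ≤ u → u ≤ v → v ≤ T → Λ u ≤ Λ v := fun u v hu huv hv =>
    sub_nonneg.1 ((abs_nonneg _).trans (abs_primitive_sub_le hr hu huv hv))
  have hKm : ∀ u v, 0 ≤ u → u ≤ v → v ≤ T → K u ≤ K v := fun u v hu huv hv =>
    hK ⟨hu, huv.trans hv⟩ ⟨hu.trans huv, hv⟩ huv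
  have hdrift := (negligible_drift G S hYc hr hint).mono (K' := fun t => K t + Λ t)
    fun u v hu huv hv => by linarith [hKm u v hu huv hv]
  have hexp := ((negligible_exp_primitive G S hT hr hB hBc).bdd_mul (β := fun _ _ => -c)
    (M := |c| + 1) (by positivity) (fun u v _ _ _ => by rw [abs_neg]; linarith)).mono
    (K' := fun t => K t + Λ t) fun u v hu huv hv => by linarith [hKm u v hu huv hv]
  replace hneg := hneg.mono (K' := fun t => K t + Λ t)
    fun u v hu huv hv => by linarith [hΛm u v hu huv hv]
  refine ⟨p, fun t => K t + Λ t, hp, fun u hu v hv huv =>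
    add_le_add (hK hu hv huv) (hΛm u v hu.1 huv hv.2), fun u v hu huv hv => ?_, hXc,
    ((hneg.add hdrift).add hexp).congr fun u v hu huv hv => ?_⟩
  · linarith [hQK u v hu huv hv, hΛm u v hu huv hv]
  · have hSu := (hSpos u hu).ne'
    have hξu : ξ u * S u = m u * X u := by rw [hξ u hu]; field_simp
    have hξ' : X u * (m u / S u * (S v - S u)) = ξ u * (S v - S u) := by
      rw [hξ u hu]; ring
    have hY : V u - ξ u * S u - c * B u = (1 - m u) * X u := by
      rw [hξu]; linear_combination -hX u
    rw [mul_add, hξ', hX v, hV v (hu.trans huv)]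
    have hXu : X u = V 0 + I u + (∫ s in (0 : ℝ)..u, (V s - ξ s * S s) * r s) - c * B u := by
      rw [hX u, hV u hu]
    linear_combination -hXu +
      ((∫ s in (0 : ℝ)..v, r s) - ∫ s in (0 : ℝ)..u, r s) * hY

/-- A function whose increments are asymptotically proportional to those of the compensated
quadratic variation is constant. -/
theorem eq_of_negligible_sub_compensated {G : GridSeq} {S Q Z w K : ℝ → ℝ} {T : ℝ} (hT : 0 < T)
    (hQ : HasQV G S Q) (hZ : ContinuousOn Z (Set.Icc 0 T))
    (hw : ContinuousOn w (Set.Icc 0 T)) (hK : MonotoneOn K (Set.Icc 0 T))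
    (hQK : ∀ u v, 0 ≤ u → u ≤ v → v ≤ T → Q v - Q u ≤ K v - K u)
    (h : Negligible G S K T (fun u v => Z v - Z u - w u * ((S v - S u) ^ 2 - (Q v - Q u)))) :
    Z T = Z 0 := by
  have hlocal : ∀ ε > 0, ∃ δ > 0, ∀ u v, u ∈ G.points → 0 ≤ u → u ≤ v → v ≤ T → v ≤ u + δ →
      |Z v - Z u| ≤ ε * (K v - K u) := by
    intro ε hε
    obtain ⟨δ, hδ, h⟩ := h (ε / 4) (by positivity)
    obtain ⟨δ', hδ', hmod⟩ := exists_modulus hw (ε := ε / 4) (by positivity)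
    refine ⟨min δ δ', by positivity, fun u v hu hu0 huv hv hd => ?_⟩
    obtain ⟨n, s, hs0, hsm, hsv, hsp, hslim, hsum⟩ := G.exists_refinement hu huv
    have hsmem : ∀ k, ∀ i ≤ n k, u ≤ s k i ∧ s k i ≤ v := fun k i hi =>
      ⟨hs0 k ▸ (hsm k).monotone (Nat.zero_le i), ((hsm k).monotone hi).trans (hsv k)⟩
    have d1 := min_le_left δ δ'
    have d2 := min_le_right δ δ'
    have hKs : ∀ k, K (s k (n k)) ≤ K v := fun k =>
      hK ⟨hu0.trans (hsmem k _ le_rfl).1, (hsv k).trans hv⟩ ⟨hu0.trans huv, hv⟩ (hsv k)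
    have hkey : ∀ k, |Z (s k (n k)) - Z u - w u *
        (∑ i ∈ Finset.range (n k), (S (s k (i + 1)) - S (s k i)) ^ 2 - (Q (s k (n k)) - Q u))| ≤
        ε / 4 * (2 * ∑ i ∈ Finset.range (n k), (S (s k (i + 1)) - S (s k i)) ^ 2 +
          2 * (K v - K u)) := by
      intro k
      have hstep : ∀ j ≤ n k, |Z (s k j) - Z u - w u *
          (∑ i ∈ Finset.range j, (S (s k (i + 1)) - S (s k i)) ^ 2 - (Q (s k j) - Q u))| ≤
          ε / 4 * (2 * ∑ i ∈ Finset.range j, (S (s k (i + 1)) - S (s k i)) ^ 2 +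
            2 * (K (s k j) - K u)) := by
        intro j
        induction j with
        | zero => intro _; simp [hs0]
        | succ j ih =>
          intro hj
          have h0 := ih (by omega)
          obtain ⟨m1, m2⟩ := hsmem k j (by omega)
          obtain ⟨m3, m4⟩ := hsmem k (j + 1) hj
          have m5 : s k j ≤ s k (j + 1) := (hsm k).monotone (Nat.le_succ j)
          have h1 := h _ _ (hsp k j) (hu0.trans m1) m5 (m4.trans hv) (by linarith)
          have h2 := hmod u _ hu0 m1 (m2.trans hv) (by linarith)
          have h3 := hQ.mono (hu0.trans m1) m5
          have h4 := hQK _ _ (hu0.trans m1) m5 (m4.trans hv)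
          have h5 : |(w (s k j) - w u) * ((S (s k (j + 1)) - S (s k j)) ^ 2 -
              (Q (s k (j + 1)) - Q (s k j)))| ≤ ε / 4 * ((S (s k (j + 1)) - S (s k j)) ^ 2 +
              (K (s k (j + 1)) - K (s k j))) := by
            rw [abs_mul]
            refine mul_le_mul h2 (abs_le.2 ⟨?_, ?_⟩) (abs_nonneg _) (by positivity) <;>
              linarith [sq_nonneg (S (s k (j + 1)) - S (s k j))]
          rw [Finset.sum_range_succ]
          rw [abs_le] at h0 h1 h5 ⊢
          constructor <;> linarith [h0.1, h0.2, h1.1, h1.2, h5.1, h5.2]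
      refine (hstep (n k) le_rfl).trans ?_
      gcongr
      exact hKs k
    have hcomp : ∀ {f : ℝ → ℝ}, ContinuousOn f (Set.Icc 0 T) →
        Tendsto (fun k => f (s k (n k))) atTop (𝓝 (f v)) := fun hf =>
      (hf v ⟨hu0.trans huv, hv⟩).tendsto.comp (tendsto_nhdsWithin_iff.2
        ⟨hslim, Eventually.of_forall fun k =>
          ⟨hu0.trans (hsmem k _ le_rfl).1, (hsv k).trans hv⟩⟩)
    have hlimQ := hsum _ _ _ (hQ.2.2 u) (hQ.2.2 v)
    have hlim := le_of_tendsto_of_tendsto'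
      (((hcomp hZ).sub_const (Z u)).sub ((hlimQ.sub
        ((hcomp (hQ.1.mono Set.Icc_subset_Ici_self)).sub_const (Q u))).const_mul (w u))).abs
      (((hlimQ.const_mul 2).add_const (2 * (K v - K u))).const_mul (ε / 4)) hkey
    rw [sub_self, mul_zero, sub_zero] at hlim
    have := mul_le_mul_of_nonneg_left (hQK u v hu0 huv hv) hε.le
    linarith
  have hglobal : ∀ ε > 0, |Z T - Z 0| ≤ ε * (K T - K 0) := by
    intro ε hε
    obtain ⟨δ, hδ, hloc⟩ := hlocal ε hε
    obtain ⟨n, s, hs0, hsm, hsT, hTs, hsp, hmesh⟩ := G.exists_partition hδ hT.le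
    have hle : ∀ i ≤ n, s i ≤ T := fun i hi => (hsm.monotone hi).trans hsT
    have hstep : ∀ j ≤ n, |Z (s j) - Z 0| ≤ ε * (K (s j) - K 0) := by
      intro j
      induction j with
      | zero => intro _; simp [hs0]
      | succ j ih =>
        intro hj
        have h0 := ih (by omega)
        have h1 := hloc _ _ (hsp j) (G.points_nonneg (hsp j)) (hsm.monotone (Nat.le_succ j))
          (hle _ hj) (hmesh j)
        rw [abs_le] at h0 h1 ⊢
        constructor <;> linarith [h0.1, h0.2, h1.1, h1.2]
    have h0 := hstep n le_rfl
    have h1 := hloc _ _ (hsp n) (G.points_nonneg (hsp n)) hsT le_rfl hTs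
    rw [abs_le] at h0 h1 ⊢
    constructor <;> linarith [h0.1, h0.2, h1.1, h1.2]
  have hlim : Tendsto (fun ε : ℝ => ε * (K T - K 0)) (𝓝[>] 0) (𝓝 0) := by
    have : Tendsto (fun ε : ℝ => ε * (K T - K 0)) (𝓝 0) (𝓝 (0 * (K T - K 0))) :=
      (continuous_id.mul continuous_const).tendsto 0
    rw [zero_mul] at this
    exact this.mono_left nhdsWithin_le_nhds
  have : |Z T - Z 0| ≤ 0 := ge_of_tendsto hlim
    (by filter_upwards [self_mem_nhdsWithin] with ε hε using hglobal ε hε)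
  exact sub_eq_zero.1 (abs_nonpos_iff.1 this)

/-- Two solutions of the same linear equation, one of them positive, are proportional. -/
theorem div_eq_div_of_expansion {G : GridSeq} {S Q C D p q K : ℝ → ℝ} {e : ℝ → ℝ → ℝ} {T : ℝ}
    (hT : 0 < T) (hQ : HasQV G S Q)
    (hC : ContinuousOn C (Set.Icc 0 T)) (hD : ContinuousOn D (Set.Icc 0 T))
    (hp : ContinuousOn p (Set.Icc 0 T)) (hq : ContinuousOn q (Set.Icc 0 T))
    (hCpos : ∀ t ∈ Set.Icc 0 T, 0 < C t) (hK : MonotoneOn K (Set.Icc 0 T))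
    (hQK : ∀ u v, 0 ≤ u → u ≤ v → v ≤ T → Q v - Q u ≤ K v - K u)
    (hDe : Negligible G S K T (fun u v => D v - D u - D u * e u v -
      p u * ((S v - S u) ^ 2 - (Q v - Q u))))
    (hCe : Negligible G S K T (fun u v => C v - C u - C u * e u v -
      q u * ((S v - S u) ^ 2 - (Q v - Q u)))) :
    D T / C T = D 0 / C 0 := by
  have hC0 : ∀ t ∈ Set.Icc 0 T, C t ≠ 0 := fun t ht => (hCpos t ht).ne'
  have hw : ContinuousOn (fun t => (C t * p t - D t * q t) / C t ^ 2) (Set.Icc 0 T) :=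
    ((hC.mul hp).sub (hD.mul hq)).div (hC.pow 2) fun t ht => pow_ne_zero 2 (hC0 t ht)
  have hZ : ContinuousOn (fun t => D t / C t) (Set.Icc 0 T) := hD.div hC hC0
  obtain ⟨M, hM, hinv⟩ := exists_abs_le (hC.inv₀ hC0)
  obtain ⟨M₁, hM₁, hZM⟩ := exists_abs_le hZ
  obtain ⟨M₂, hM₂, hwM⟩ := exists_abs_le hw
  have hθ : Negligible G S K T (fun u v =>
      (C u - C v) * ((S v - S u) ^ 2 - (Q v - Q u))) := by
    intro ε hε
    obtain ⟨δ, hδ, hmod⟩ := exists_modulus hC hε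
    refine ⟨δ, hδ, fun u v _ hu huv hv hd => ?_⟩
    have h1 := hmod u v hu huv hv hd
    have h2 := hQ.mono hu huv
    have h3 := hQK u v hu huv hv
    rw [dist_comm, Real.dist_eq] at h1
    rw [abs_mul]
    refine mul_le_mul h1 (abs_le.2 ⟨?_, ?_⟩) (abs_nonneg _) hε.le <;>
      linarith [sq_nonneg (S v - S u)]
  have t1 := hDe.bdd_mul (β := fun _ v => (C v)⁻¹) hM
    fun u v hu huv hv => hinv v (hu.trans huv) hv
  have t2 := hCe.bdd_mul (β := fun u v => -(D u / C u * (C v)⁻¹)) (mul_pos hM₁ hM)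
    fun u v hu huv hv => by
      rw [abs_neg, abs_mul]
      exact mul_le_mul (hZM u hu (huv.trans hv)) (hinv v (hu.trans huv) hv) (abs_nonneg _) hM₁.le
  have t3 := hθ.bdd_mul (β := fun u v => (C u * p u - D u * q u) / C u ^ 2 * (C v)⁻¹)
    (mul_pos hM₂ hM) fun u v hu huv hv => by
      rw [abs_mul]
      exact mul_le_mul (hwM u hu (huv.trans hv)) (hinv v (hu.trans huv) hv) (abs_nonneg _) hM₂.le
  refine eq_of_negligible_sub_compensated hT hQ hZ hw hK hQK
    (((t1.add t2).add t3).congr fun u v hu huv hv => ?_)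
  have hu' := hC0 u ⟨hu, huv.trans hv⟩
  have hv' := hC0 v ⟨hu.trans huv, hv⟩
  field_simp
  ring

theorem ConvTo.eq_zero_of_zero {G : GridSeq} {f : ℝ → ℝ → ℝ} {L : ℝ} (h : ConvTo G f 0 L) :
    L = 0 := by
  refine tendsto_nhds_unique h (tendsto_const_nhds.congr fun N => ?_)
  obtain ⟨k, hk, -, hsum⟩ := G.exists_cell N (le_refl 0)
  have hk0 : k = 0 := by
    rw [← G.zero N] at hk
    exact Nat.le_zero.1 ((G.mono N).le_iff_le.1 hk)
  rw [hsum f, hk0, Finset.sum_range_zero]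

/-- uniqueness of the DPPI strategy. -/
theorem stmt15 (G : GridSeq) (S QS r m B : ℝ → ℝ)
    (hS : ContinuousOn S (Set.Ici 0)) (hSpos : ∀ t ∈ Set.Ici (0 : ℝ), 0 < S t)
    (hQS : HasQV G S QS)
    (hm : Admissible S m)
    (hr : ∀ t > 0, IntervalIntegrable r MeasureTheory.volume 0 t)
    (hB : ∀ t, B t = Real.exp (∫ s in (0 : ℝ)..t, r s))
    (V₀ α : ℝ) (hV₀ : 0 < V₀) (hα : α ∈ Set.Ico (0 : ℝ) 1)
    (I₁ I₂ : ℝ → ℝ)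
    (hI₁ : ∀ t, ConvTo G (fun u v => m u / S u * (S v - S u)) t (I₁ t))
    (hI₂ : ∀ t, ConvTo G (fun u v => (m u / S u) ^ 2 * (QS v - QS u)) t (I₂ t))
    (C V ξ η : ℝ → ℝ)
    (hC : ∀ t, C t = (1 - α) * V₀ *
      Real.exp (I₁ t - I₂ t / 2 + ∫ s in (0 : ℝ)..t, (1 - m s) * r s))
    (hV : ∀ t, V t = C t + α * V₀ * B t)
    (hξ : ∀ t, ξ t = m t * C t / S t)
    (hη : ∀ t, η t = (V t - ξ t * S t) / B t)
    (hSF : SelfFinancing G S B r ξ η V)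
    (ξ' η' V' : ℝ → ℝ)
    (hSF' : SelfFinancing G S B r ξ' η' V')
    (hV'0 : V' 0 = V₀)
    (hξ' : ∀ t ≥ (0 : ℝ), ξ' t = m t * (V' t - α * V₀ * B t) / S t) :
    ∀ t ≥ 0, V' t - α * V₀ * B t = C t ∧ ξ' t = ξ t ∧ η' t = η t := by

  have hB0 : B 0 = 1 := by simp [hB]
  have hBpos : ∀ t, 0 < B t := fun t => by rw [hB]; exact Real.exp_pos _
  have hCpos : ∀ t, 0 < C t := fun t => by
    rw [hC]
    exact mul_pos (mul_pos (sub_pos.2 hα.2) hV₀) (Real.exp_pos _)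
  have hC0 : C 0 = (1 - α) * V₀ := by
    simp [hC, (hI₁ 0).eq_zero_of_zero, (hI₂ 0).eq_zero_of_zero]
  have hD0 : V' 0 - α * V₀ * B 0 = C 0 := by rw [hV'0, hB0, hC0]; ring
  have key : ∀ t ≥ 0, V' t - α * V₀ * B t = C t := by
    intro t ht
    rcases ht.eq_or_lt with rfl | hT
    · exact hD0
    obtain ⟨p, K, hp, hK, hQK, hDc, hDe⟩ := hSF'.exists_expansion_cushion hT hS hSpos hQS
      (hr t hT) hB (X := fun t => V' t - α * V₀ * B t) (m := m) (fun _ => rfl) hξ'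
    obtain ⟨q, L, hq, hL, hQL, hCc, hCe⟩ := hSF.exists_expansion_cushion hT hS hSpos hQS
      (hr t hT) hB (X := C) (m := m) (c := α * V₀) (fun s => by rw [hV s]; ring)
      fun s _ => hξ s
    have hKm : ∀ u v, 0 ≤ u → u ≤ v → v ≤ t → K u ≤ K v := fun u v hu huv hv =>
      hK ⟨hu, huv.trans hv⟩ ⟨hu.trans huv, hv⟩ huv
    have hLm : ∀ u v, 0 ≤ u → u ≤ v → v ≤ t → L u ≤ L v := fun u v hu huv hv =>
      hL ⟨hu, huv.trans hv⟩ ⟨hu.trans huv, hv⟩ huv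
    have hdiv := div_eq_div_of_expansion hT hQS hCc hDc hp hq (fun s _ => hCpos s)
      (K := fun s => K s + L s)
      (fun u hu v hv huv => add_le_add (hK hu hv huv) (hL hu hv huv))
      (fun u v hu huv hv => by linarith [hQK u v hu huv hv, hLm u v hu huv hv])
      (hDe.mono fun u v hu huv hv => by linarith [hLm u v hu huv hv])
      (hCe.mono fun u v hu huv hv => by linarith [hKm u v hu huv hv])
    rwa [hD0, div_self (hCpos 0).ne', div_eq_one_iff_eq (hCpos t).ne'] at hdiv
  intro t ht
  have hCt := key t ht
  have hξt : ξ' t = ξ t := by rw [hξ' t ht, hξ t, hCt]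
  refine ⟨hCt, hξt, ?_⟩
  have hval := hSF'.2.2.1 t
  rw [hη t, eq_div_iff (hBpos t).ne', hV t, ← hCt, ← hξt]
  linarith
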